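/- Let E be a complete geodesic metric space with convex metric and curvature bounded below by κ<0, and let A be a nonempty, bounded and closed subset of E. Then the set W_min = { X ∈ P^A_{b,cl,cv}(E) : min(A,X) is well-posed } is a dense G_δ-set in the metric space (P^A_{b,cl,cv}(E), h). -/

import Mathlib

open Metric Set Filter Bornology

noncomputable section

/-- A geodesic path of length `l`: a map `c : ℝ → E` that is isometric on `[0, l]`. -/
def IsGeodesicPath {E : Type*} [MetricSpace E] (c : ℝ → E) (l : ℝ) : Prop :=
  0 ≤ l ∧ ∀ s ∈ Icc (0:ℝ) l, ∀ t ∈ Icc (0:ℝ) l, dist (c s) (c t) = |s - t|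

/-- `S` is a geodesic segment joining `x` and `y`. -/
def IsGeodesicSegment {E : Type*} [MetricSpace E] (S : Set E) (x y : E) : Prop :=
  ∃ c l, IsGeodesicPath c l ∧ c 0 = x ∧ c l = y ∧ S = c '' Icc (0:ℝ) l

/-- A geodesic (line): an isometric image of `ℝ`. -/
def IsGeodesicLine {E : Type*} [MetricSpace E] (S : Set E) : Prop :=
  ∃ c : ℝ → E, Isometry c ∧ S = Set.range c

/-- `E` is a geodesic space: every two points are joined by a geodesic path. -/
def IsGeodesicSpace (E : Type*) [MetricSpace E] : Prop :=
  ∀ x y : E, ∃ S, IsGeodesicSegment S x y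

/-- `E` has the geodesic extension property: every geodesic segment is contained
in a geodesic. -/
def GeodesicExtensionProperty (E : Type*) [MetricSpace E] : Prop :=
  ∀ (S : Set E) (x y : E), IsGeodesicSegment S x y → ∃ L, IsGeodesicLine L ∧ S ⊆ L

/-- The metric of `E` is convex. -/
def HasConvexMetric (E : Type*) [MetricSpace E] : Prop :=
  ∀ (c₁ c₂ : ℝ → E) (l₁ l₂ : ℝ), IsGeodesicPath c₁ l₁ → IsGeodesicPath c₂ l₂ →
    ∀ t ∈ Icc (0:ℝ) 1,
      dist (c₁ (t * l₁)) (c₂ (t * l₂)) ≤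
        (1 - t) * dist (c₁ 0) (c₂ 0) + t * dist (c₁ l₁) (c₂ l₂)

/-- A subset `X` is (geodesically) convex: any geodesic segment joining two points
of `X` is contained in `X`. -/
def GeodesicConvex {E : Type*} [MetricSpace E] (X : Set E) : Prop :=
  ∀ x ∈ X, ∀ y ∈ X, ∀ S : Set E, IsGeodesicSegment S x y → S ⊆ X

/-- A function `f : E → ℝ` is (geodesically) convex. -/
def GeodesicConvexFun {E : Type*} [MetricSpace E] (f : E → ℝ) : Prop :=
  ∀ (c : ℝ → E) (l : ℝ), IsGeodesicPath c l → ∀ t ∈ Icc (0:ℝ) 1,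
    f (c (t * l)) ≤ (1 - t) * f (c 0) + t * f (c l)

/-- `G₁(S)`: the union of all geodesic segments with endpoints in `S`. -/
def geodSegUnion {E : Type*} [MetricSpace E] (S : Set E) : Set E :=
  {z | ∃ x ∈ S, ∃ y ∈ S, ∃ T : Set E, IsGeodesicSegment T x y ∧ z ∈ T}

/-- The iterates `G_n(S)`. -/
def geodGn {E : Type*} [MetricSpace E] (S : Set E) : ℕ → Set E
  | 0 => S
  | n + 1 => geodSegUnion (geodGn S n)

/-- The (geodesic) convex hull `co(S) = ⋃ₙ G_n(S)`. -/
def geodConvexHull {E : Type*} [MetricSpace E] (S : Set E) : Set E :=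
  ⋃ n, geodGn S n

/-- `E` is without bifurcating geodesics. -/
def NoBifurcatingGeodesics (E : Type*) [MetricSpace E] : Prop :=
  ∀ (p a b : E) (S₁ S₂ : Set E), IsGeodesicSegment S₁ p a → IsGeodesicSegment S₂ p b →
    ∀ z, z ∈ S₁ → z ∈ S₂ → z ≠ p → (z = a ∧ z = b) ∨ S₁ ⊆ S₂ ∨ S₂ ⊆ S₁

/-- `E` is reflexive: every descending sequence of nonempty, bounded, closed and convex
subsets of `E` has nonempty intersection. -/
def ReflexiveGeodesicSpace (E : Type*) [MetricSpace E] : Prop :=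
  ∀ C : ℕ → Set E, (∀ n, (C n).Nonempty) → (∀ n, IsBounded (C n)) → (∀ n, IsClosed (C n)) →
    (∀ n, GeodesicConvex (C n)) → (∀ n, C (n + 1) ⊆ C n) → (⋂ n, C n).Nonempty

/-- `Dist(x, A)`: the remotal (farthest) distance from `x` to `A`. -/
def supDist {E : Type*} [MetricSpace E] (x : E) (A : Set E) : ℝ :=
  sSup ((fun a => dist x a) '' A)

/-- `λ_{XY} = inf{ d(x,y) : x ∈ X, y ∈ Y }`. -/
def infSetDist {E : Type*} [MetricSpace E] (X Y : Set E) : ℝ :=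
  sInf (Set.image2 dist X Y)

/-- `μ_{XY} = sup{ d(x,y) : x ∈ X, y ∈ Y }`. -/
def supSetDist {E : Type*} [MetricSpace E] (X Y : Set E) : ℝ :=
  sSup (Set.image2 dist X Y)

/-- `L_{XY}(σ) = { x ∈ X : dist(x,Y) ≤ λ_{XY} + σ }`. -/
def Lset {E : Type*} [MetricSpace E] (X Y : Set E) (σ : ℝ) : Set E :=
  {x ∈ X | infDist x Y ≤ infSetDist X Y + σ}

/-- `M_{XY}(σ) = { x ∈ X : Dist(x,Y) ≥ μ_{XY} − σ }`. -/
def Mset {E : Type*} [MetricSpace E] (X Y : Set E) (σ : ℝ) : Set E :=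
  {x ∈ X | supSetDist X Y - σ ≤ supDist x Y}

/-- The minimization problem `min(X,Y)` is well-posed. -/
def MinWellPosed {E : Type*} [MetricSpace E] (X Y : Set E) : Prop :=
  ∃ x₀ ∈ X, ∃ y₀ ∈ Y, dist x₀ y₀ = infSetDist X Y ∧
    (∀ x ∈ X, ∀ y ∈ Y, dist x y = infSetDist X Y → x = x₀ ∧ y = y₀) ∧
    ∀ x : ℕ → E, ∀ y : ℕ → E, (∀ n, x n ∈ X) → (∀ n, y n ∈ Y) →
      Tendsto (fun n => dist (x n) (y n)) atTop (nhds (infSetDist X Y)) →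
      Tendsto x atTop (nhds x₀) ∧ Tendsto y atTop (nhds y₀)

/-- The maximization problem `max(X,Y)` is well-posed. -/
def MaxWellPosed {E : Type*} [MetricSpace E] (X Y : Set E) : Prop :=
  ∃ x₀ ∈ X, ∃ y₀ ∈ Y, dist x₀ y₀ = supSetDist X Y ∧
    (∀ x ∈ X, ∀ y ∈ Y, dist x y = supSetDist X Y → x = x₀ ∧ y = y₀) ∧
    ∀ x : ℕ → E, ∀ y : ℕ → E, (∀ n, x n ∈ X) → (∀ n, y n ∈ Y) →
      Tendsto (fun n => dist (x n) (y n)) atTop (nhds (supSetDist X Y)) →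
      Tendsto x atTop (nhds x₀) ∧ Tendsto y atTop (nhds y₀)

/-- The distance of the model space `M²_κ` (κ < 0): the hyperbolic distance
multiplied by `1/√(-κ)`. -/
def kdist (κ : ℝ) (a b : UpperHalfPlane) : ℝ :=
  (Real.sqrt (-κ))⁻¹ * dist a b

/-- `pb` is the comparison point in `M²_κ` (relative to the side from `xi` to `xj`,
with comparison vertices `xib`, `xjb`) of a point `p` on a geodesic segment from
`xi` to `xj`. -/
def IsComparisonPoint {E : Type*} [MetricSpace E] (κ : ℝ) (xi xj : E)
    (xib xjb : UpperHalfPlane) (p : E) (pb : UpperHalfPlane) : Prop :=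
  kdist κ xib pb = dist xi p ∧ kdist κ pb xjb = dist p xj

/-- `E` has curvature bounded below by `κ < 0`: every geodesic triangle satisfies the
reversed CAT(κ) inequality with respect to any κ-comparison triangle in `M²_κ`. -/
def CurvBoundedBelow (E : Type*) [MetricSpace E] (κ : ℝ) : Prop :=
  ∀ (x₁ x₂ x₃ : E) (S₁₂ S₂₃ S₁₃ : Set E),
    IsGeodesicSegment S₁₂ x₁ x₂ → IsGeodesicSegment S₂₃ x₂ x₃ → IsGeodesicSegment S₁₃ x₁ x₃ →
    ∀ x₁b x₂b x₃b : UpperHalfPlane,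
      kdist κ x₁b x₂b = dist x₁ x₂ → kdist κ x₂b x₃b = dist x₂ x₃ →
      kdist κ x₁b x₃b = dist x₁ x₃ →
      ∀ (p q : E) (pb qb : UpperHalfPlane),
        ((p ∈ S₁₂ ∧ IsComparisonPoint κ x₁ x₂ x₁b x₂b p pb) ∨
         (p ∈ S₂₃ ∧ IsComparisonPoint κ x₂ x₃ x₂b x₃b p pb) ∨
         (p ∈ S₁₃ ∧ IsComparisonPoint κ x₁ x₃ x₁b x₃b p pb)) →
        ((q ∈ S₁₂ ∧ IsComparisonPoint κ x₁ x₂ x₁b x₂b q qb) ∨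
         (q ∈ S₂₃ ∧ IsComparisonPoint κ x₂ x₃ x₂b x₃b q qb) ∨
         (q ∈ S₁₃ ∧ IsComparisonPoint κ x₁ x₃ x₁b x₃b q qb)) →
        kdist κ pb qb ≤ dist p q

/-- Comparison points for Euclidean (κ = 0) comparison triangles in `ℝ²`. -/
def IsComparisonPointE {E : Type*} [MetricSpace E] (xi xj : E)
    (xib xjb : EuclideanSpace ℝ (Fin 2)) (p : E) (pb : EuclideanSpace ℝ (Fin 2)) : Prop :=
  dist xib pb = dist xi p ∧ dist pb xjb = dist p xj

/-- `E` is a CAT(0) space: a geodesic space where every geodesic triangle satisfies the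
CAT(0) comparison inequality with respect to Euclidean comparison triangles. -/
def CATZero (E : Type*) [MetricSpace E] : Prop :=
  IsGeodesicSpace E ∧
  ∀ (x₁ x₂ x₃ : E) (S₁₂ S₂₃ S₁₃ : Set E),
    IsGeodesicSegment S₁₂ x₁ x₂ → IsGeodesicSegment S₂₃ x₂ x₃ → IsGeodesicSegment S₁₃ x₁ x₃ →
    ∀ x₁b x₂b x₃b : EuclideanSpace ℝ (Fin 2),
      dist x₁b x₂b = dist x₁ x₂ → dist x₂b x₃b = dist x₂ x₃ → dist x₁b x₃b = dist x₁ x₃ →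
      ∀ (p q : E) (pb qb : EuclideanSpace ℝ (Fin 2)),
        ((p ∈ S₁₂ ∧ IsComparisonPointE x₁ x₂ x₁b x₂b p pb) ∨
         (p ∈ S₂₃ ∧ IsComparisonPointE x₂ x₃ x₂b x₃b p pb) ∨
         (p ∈ S₁₃ ∧ IsComparisonPointE x₁ x₃ x₁b x₃b p pb)) →
        ((q ∈ S₁₂ ∧ IsComparisonPointE x₁ x₂ x₁b x₂b q qb) ∨
         (q ∈ S₂₃ ∧ IsComparisonPointE x₂ x₃ x₂b x₃b q qb) ∨
         (q ∈ S₁₃ ∧ IsComparisonPointE x₁ x₃ x₁b x₃b q qb)) →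
        dist p q ≤ dist pb qb

/-- The space `P_{b,cl,cv}(E)` of nonempty, bounded, closed and convex subsets of `E`. -/
def Pbclcv (E : Type*) [MetricSpace E] : Type _ :=
  {X : Set E // X.Nonempty ∧ IsBounded X ∧ IsClosed X ∧ GeodesicConvex X}

/-- `P_{b,cl,cv}(E)` carries the Pompeiu-Hausdorff distance. -/
instance Pbclcv.metricSpace (E : Type*) [MetricSpace E] : MetricSpace (Pbclcv E) where
  dist X Y := hausdorffDist X.1 Y.1
  dist_self X := hausdorffDist_self_zero
  dist_comm X Y := hausdorffDist_comm
  dist_triangle X Y Z := hausdorffDist_triangle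
    (hausdorffEdist_ne_top_of_nonempty_of_bounded X.2.1 Y.2.1 X.2.2.1 Y.2.2.1)
  eq_of_dist_eq_zero := by
    intro X Y h
    exact Subtype.ext ((X.2.2.2.1.hausdorffDist_zero_iff_eq Y.2.2.2.1
      (hausdorffEdist_ne_top_of_nonempty_of_bounded X.2.1 Y.2.1 X.2.2.1 Y.2.2.1)).mp h)

/-- `P^A_{b,cl,cv}(E)`: the closure in `(P_{b,cl,cv}(E), h)` of the family of sets at
positive distance from `A`. -/
def PAbclcv {E : Type*} [MetricSpace E] (A : Set E) : Set (Pbclcv E) :=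
  closure {X : Pbclcv E | 0 < infSetDist X.1 A}

/-- The inverse hyperbolic cosine. -/
def arcosh (x : ℝ) : ℝ := Real.log (x + Real.sqrt (x ^ 2 - 1))

/-- The function `F_κ`. -/
def Fkappa (κ d r σ : ℝ) : ℝ :=
  2 / Real.sqrt (-κ) *
    arcosh (Real.cosh (Real.sqrt (-κ) * (r - d + σ)) ^ 2 -
      Real.sinh (Real.sqrt (-κ) * (r - d + σ)) / Real.sinh (Real.sqrt (-κ) * d) *
        (Real.cosh (Real.sqrt (-κ) * r) -
          Real.cosh (Real.sqrt (-κ) * d) * Real.cosh (Real.sqrt (-κ) * (r - d + σ))))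

/-- The petal `P_{α,δ}(x₀, f)`. -/
def petal {E : Type*} [MetricSpace E] (f : E → ℝ) (α δ : ℝ) (x₀ : E) : Set E :=
  {x | f x ≤ f x₀ - α * dist x x₀ + δ}

/-- `L_{A,f}(σ)`. -/
def LsetFun {E : Type*} [MetricSpace E] (A : Set E) (f : E → ℝ) (σ : ℝ) : Set E :=
  {x | f x ≤ sInf (f '' A) + σ ∧ infDist x A ≤ σ}

/-- The problem `min(A,f)` is well-posed in the sense of Revalski. -/
def RevalskiWellPosed {E : Type*} [MetricSpace E] (A : Set E) (f : E → ℝ) : Prop :=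
  sInf ((fun σ => diam (LsetFun A f σ)) '' Ioi 0) = 0

/-- The nearest point problem `min(X,y)` is well-posed. -/
def PointMinWellPosed {E : Type*} [MetricSpace E] (X : Set E) (y : E) : Prop :=
  ∃ x₀ ∈ X, dist x₀ y = infDist y X ∧ (∀ x ∈ X, dist x y = infDist y X → x = x₀) ∧
    ∀ x : ℕ → E, (∀ n, x n ∈ X) →
      Tendsto (fun n => dist (x n) y) atTop (nhds (infDist y X)) →
      Tendsto x atTop (nhds x₀)

end

/-- The point at signed distance `t` above `i` on the imaginary axis of the upper half-plane. -/
noncomputable def verticalPoint (t : ℝ) : UpperHalfPlane := ⟨⟨0, Real.exp t⟩, Real.exp_pos t⟩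

theorem verticalPoint_re (t : ℝ) : (verticalPoint t).re = 0 := rfl

theorem verticalPoint_im (t : ℝ) : (verticalPoint t).im = Real.exp t := rfl

theorem dist_verticalPoint (s t : ℝ) : dist (verticalPoint s) (verticalPoint t) = |s - t| := by
  rw [UpperHalfPlane.dist_of_re_eq (by simp only [verticalPoint_re]), verticalPoint_im,
    verticalPoint_im, Real.log_exp, Real.log_exp, Real.dist_eq]

theorem cosh_dist_verticalPoint (t : ℝ) (z : UpperHalfPlane) :
    Real.cosh (dist (verticalPoint t) z) =
      (z.re ^ 2 + z.im ^ 2) / (2 * z.im) * Real.exp (-t) + 1 / (2 * z.im) * Real.exp t := by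
  rw [UpperHalfPlane.cosh_dist', verticalPoint_re, verticalPoint_im, Real.exp_neg]
  have h1 := z.im_pos.ne'
  have h2 := (Real.exp_pos t).ne'
  field_simp
  ring

/-- The hyperbolic Stewart identity. -/
theorem sinh_mul_cosh_dist_verticalPoint (e w : ℝ) (z : UpperHalfPlane) :
    Real.sinh w * Real.cosh (dist (verticalPoint e) z) =
      Real.sinh (w - e) * Real.cosh (dist (verticalPoint 0) z) +
        Real.sinh e * Real.cosh (dist (verticalPoint w) z) := by
  simp only [cosh_dist_verticalPoint, Real.sinh_eq, neg_sub, neg_zero, Real.exp_zero,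
    Real.exp_sub, Real.exp_neg]
  have h1 := z.im_pos.ne'
  have h2 := (Real.exp_pos e).ne'
  have h3 := (Real.exp_pos w).ne'
  field_simp
  ring

/-- Existence of hyperbolic triangles with prescribed side lengths. -/
theorem exists_dist_verticalPoint_eq {u v w : ℝ} (hw : 0 < w) (hu : 0 ≤ u)
    (h₁ : |u - w| ≤ v) (h₂ : v ≤ u + w) :
    ∃ z, dist (verticalPoint 0) z = u ∧ dist (verticalPoint w) z = v := by
  have hv : 0 ≤ v := (abs_nonneg _).trans h₁
  have hsw : 0 < Real.sinh w := Real.sinh_pos_iff.2 hw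
  have hsu : 0 ≤ Real.sinh u := Real.sinh_nonneg_iff.2 hu
  have hc₁ : Real.cosh (u - w) ≤ Real.cosh v := by
    rw [Real.cosh_le_cosh, abs_of_nonneg hv]; exact h₁
  have hc₂ : Real.cosh v ≤ Real.cosh (u + w) := by
    rw [Real.cosh_le_cosh, abs_of_nonneg hv, abs_of_nonneg (by linarith)]; exact h₂
  rw [Real.cosh_sub] at hc₁
  rw [Real.cosh_add] at hc₂
  obtain ⟨m, hm⟩ : ∃ m, m * Real.sinh w = Real.cosh u * Real.cosh w - Real.cosh v :=
    ⟨_, div_mul_cancel₀ _ hsw.ne'⟩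
  have hm₁ : m ≤ Real.sinh u := le_of_mul_le_mul_right (by linarith) hsw
  have hm₂ : -Real.sinh u ≤ m := le_of_mul_le_mul_right (by linarith) hsw
  have hR : 0 < Real.cosh u - m := by linarith [Real.sinh_lt_cosh u]
  have hP : 0 ≤ (Real.cosh u + m) * (Real.cosh u - m) - 1 := by
    nlinarith [Real.cosh_sq u, abs_le_of_sq_le_sq' (a := m) (b := Real.sinh u)]
  have key : ∀ t, Real.cosh (dist (verticalPoint t)
      ⟨⟨√((Real.cosh u + m) * (Real.cosh u - m) - 1) / (Real.cosh u - m),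
        1 / (Real.cosh u - m)⟩, one_div_pos.2 hR⟩) =
      Real.cosh u * Real.cosh t - m * Real.sinh t := by
    intro t
    rw [cosh_dist_verticalPoint]
    simp only [UpperHalfPlane.re, UpperHalfPlane.im, div_pow, Real.sq_sqrt hP]
    rw [Real.cosh_eq t, Real.sinh_eq t]
    field_simp
    ring
  refine ⟨⟨⟨√((Real.cosh u + m) * (Real.cosh u - m) - 1) / (Real.cosh u - m),
    1 / (Real.cosh u - m)⟩, one_div_pos.2 hR⟩, ?_, ?_⟩
  · apply Real.cosh_strictMonoOn.injOn dist_nonneg hu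
    simpa using key 0
  · apply Real.cosh_strictMonoOn.injOn dist_nonneg hv
    rw [key w]
    linarith

theorem IsGeodesicPath.isGeodesicSegment {E : Type*} [MetricSpace E] {c : ℝ → E} {l : ℝ}
    (hc : IsGeodesicPath c l) : IsGeodesicSegment (c '' Icc 0 l) (c 0) (c l) :=
  ⟨c, l, hc, rfl, rfl, rfl⟩

theorem IsGeodesicSegment.right_mem {E : Type*} [MetricSpace E] {S : Set E} {x y : E}
    (h : IsGeodesicSegment S x y) : y ∈ S := by
  obtain ⟨c, l, hc, -, rfl, rfl⟩ := h
  exact mem_image_of_mem c (right_mem_Icc.2 hc.1)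

/-- The comparison form of the hyperbolic Stewart identity in a space with curvature
bounded below. -/
theorem CurvBoundedBelow.stewart {E : Type*} [MetricSpace E] (hgeo : IsGeodesicSpace E)
    {κ : ℝ} (hκ : κ < 0) (hcurv : CurvBoundedBelow E κ) {S : Set E} {x a y : E}
    (hS : IsGeodesicSegment S x a) (hy : y ∈ S) (hxa : 0 < dist x a)
    (hxya : dist x y + dist y a = dist x a) (b : E) :
    Real.sinh (√(-κ) * dist y a) * Real.cosh (√(-κ) * dist x b) +
      Real.sinh (√(-κ) * dist x y) * Real.cosh (√(-κ) * dist a b) ≤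
      Real.sinh (√(-κ) * dist x a) * Real.cosh (√(-κ) * dist y b) := by
  have hk : 0 < √(-κ) := Real.sqrt_pos.2 (neg_pos.2 hκ)
  set k := √(-κ) with hk_def
  have hkd : ∀ {p q : UpperHalfPlane} {r : ℝ}, dist p q = k * r → kdist κ p q = r := by
    intro p q r h
    rw [kdist, h, ← hk_def, inv_mul_cancel_left₀ hk.ne']
  have hw : 0 < k * dist x a := mul_pos hk hxa
  obtain ⟨z, hz₁, hz₂⟩ := exists_dist_verticalPoint_eq (u := k * dist x b) (v := k * dist a b)
    hw (by positivity)
    (by rw [← mul_sub, abs_mul, abs_of_pos hk]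
        gcongr
        rw [abs_le]
        constructor <;> linarith [dist_triangle x a b, dist_triangle x b a, dist_comm a b])
    (by rw [← mul_add]; gcongr; linarith [dist_triangle a x b, dist_comm a x])
  obtain ⟨S₂₃, hS₂₃⟩ := hgeo a b
  obtain ⟨S₁₃, hS₁₃⟩ := hgeo x b
  have hcmp := hcurv x a b S S₂₃ S₁₃ hS hS₂₃ hS₁₃ (verticalPoint 0)
    (verticalPoint (k * dist x a)) z
    (hkd (by rw [dist_verticalPoint, zero_sub, abs_neg, abs_of_pos hw])) (hkd hz₂) (hkd hz₁)
    y b (verticalPoint (k * dist x y)) z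
    (Or.inl ⟨hy, hkd (by rw [dist_verticalPoint, zero_sub, abs_neg, abs_of_nonneg (by positivity)]),
      hkd (by
        rw [dist_verticalPoint, ← mul_sub, ← hxya, sub_add_cancel_left, mul_neg, abs_neg,
          abs_of_nonneg (by positivity)])⟩)
    (Or.inr (Or.inl ⟨hS₂₃.right_mem, hkd hz₂, hkd (by simp)⟩))
  have hcmp' : dist (verticalPoint (k * dist x y)) z ≤ k * dist y b := by
    rwa [kdist, ← hk_def, inv_mul_le_iff₀ hk] at hcmp
  have hst := sinh_mul_cosh_dist_verticalPoint (k * dist x y) (k * dist x a) z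
  rw [hz₁, hz₂, ← mul_sub, show dist x a - dist x y = dist y a by linarith] at hst
  rw [← hst]
  refine mul_le_mul_of_nonneg_left ?_ (Real.sinh_nonneg_iff.2 hw.le)
  rw [Real.cosh_le_cosh, abs_of_nonneg dist_nonneg, abs_of_nonneg (by positivity)]
  exact hcmp'

/-- In a space with curvature bounded below, geodesics do not nearly branch, uniformly: if `y` is
at distance `ε` from `x` on a segment from `x` to `a`, and `b` is another point for which `y` is
nearly between `x` and `b`, then `a` and `b` are close. -/
theorem CurvBoundedBelow.exists_dist_le {E : Type*} [MetricSpace E] (hgeo : IsGeodesicSpace E)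
    {κ : ℝ} (hκ : κ < 0) (hcurv : CurvBoundedBelow E κ) {r ε η : ℝ} (hε : 0 < ε) (hεr : ε < r)
    (hη : 0 < η) :
    ∃ τ > 0, ∀ (S : Set E) (x a y b : E), IsGeodesicSegment S x a → y ∈ S →
      dist x y = ε → dist x y + dist y a = dist x a → r ≤ dist x a → dist x a ≤ r + τ →
      r ≤ dist x b → dist y b ≤ r - ε + τ → dist a b ≤ η := by
  have hk : 0 < √(-κ) := Real.sqrt_pos.2 (neg_pos.2 hκ)
  have hst := @CurvBoundedBelow.stewart E _ hgeo κ hκ hcurv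
  set k := √(-κ) with hk_def
  have hsε : 0 < Real.sinh (k * ε) := Real.sinh_pos_iff.2 (by positivity)
  let f : ℝ → ℝ := fun τ => Real.sinh (k * (r + τ)) * Real.cosh (k * (r - ε + τ)) -
    Real.sinh (k * (r - ε)) * Real.cosh (k * r)
  have hf : Continuous f := by
    have := Real.continuous_sinh
    have := Real.continuous_cosh
    fun_prop
  have hf0 : f 0 = Real.sinh (k * ε) := by
    have : k * ε = k * r - k * (r - ε) := by ring
    simp only [f, add_zero]
    rw [this, Real.sinh_sub]
    ring
  have hlt : f 0 < Real.sinh (k * ε) * Real.cosh (k * η) := by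
    rw [hf0]
    exact lt_mul_of_one_lt_right hsε (Real.one_lt_cosh.2 (by positivity))
  obtain ⟨τ, hτ, hτf⟩ := Metric.eventually_nhds_iff.1 (hf.continuousAt.eventually_lt_const hlt)
  refine ⟨τ / 2, by positivity, fun S x a y b hS hy hxy hxya hr₁ hr₂ hb₁ hb₂ => ?_⟩
  have hτ2 := hτf (y := τ / 2) (by rw [Real.dist_eq, sub_zero, abs_of_pos] <;> linarith)
  have h := hst hS hy (by linarith) hxya b
  rw [hxy] at h
  have hya : dist y a = dist x a - ε := by linarith
  have h1 : Real.sinh (k * dist x a) * Real.cosh (k * dist y b) ≤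
      Real.sinh (k * (r + τ / 2)) * Real.cosh (k * (r - ε + τ / 2)) := by
    refine mul_le_mul (Real.sinh_le_sinh.2 (by gcongr)) ?_ (Real.cosh_pos _).le
      (Real.sinh_nonneg_iff.2 (mul_nonneg hk.le (by linarith)))
    rw [Real.cosh_le_cosh, abs_of_nonneg (by positivity),
      abs_of_nonneg (mul_nonneg hk.le (by linarith))]
    gcongr
  have h2 : Real.sinh (k * (r - ε)) * Real.cosh (k * r) ≤
      Real.sinh (k * dist y a) * Real.cosh (k * dist x b) := by
    refine mul_le_mul (Real.sinh_le_sinh.2 ?_) ?_ (Real.cosh_pos _).le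
      (Real.sinh_nonneg_iff.2 (by positivity))
    · rw [hya]; gcongr
    · rw [Real.cosh_le_cosh, abs_of_nonneg (mul_nonneg hk.le (by linarith)),
        abs_of_nonneg (by positivity)]
      gcongr
  have h3 : Real.cosh (k * dist a b) < Real.cosh (k * η) := by
    refine lt_of_mul_lt_mul_left ?_ hsε.le
    simp only [f] at hτ2
    linarith
  rw [Real.cosh_lt_cosh, abs_of_nonneg (by positivity), abs_of_nonneg (by positivity)] at h3
  exact (lt_of_mul_lt_mul_left h3 hk.le).le

theorem infSetDist_le_dist {E : Type*} [MetricSpace E] {X Y : Set E} {x y : E} (hx : x ∈ X)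
    (hy : y ∈ Y) : infSetDist X Y ≤ dist x y := by
  refine csInf_le ⟨0, ?_⟩ (mem_image2_of_mem hx hy)
  rintro _ ⟨a, -, b, -, rfl⟩
  exact dist_nonneg

theorem le_infSetDist {E : Type*} [MetricSpace E] {X Y : Set E} {r : ℝ} (hX : X.Nonempty)
    (hY : Y.Nonempty) (h : ∀ x ∈ X, ∀ y ∈ Y, r ≤ dist x y) : r ≤ infSetDist X Y := by
  refine le_csInf (hX.image2 hY) ?_
  rintro _ ⟨a, ha, b, hb, rfl⟩
  exact h a ha b hb

theorem exists_dist_lt_infSetDist_add {E : Type*} [MetricSpace E] {X Y : Set E} {η : ℝ}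
    (hX : X.Nonempty) (hY : Y.Nonempty) (hη : 0 < η) :
    ∃ x ∈ X, ∃ y ∈ Y, dist x y < infSetDist X Y + η := by
  obtain ⟨_, ⟨x, hx, y, hy, rfl⟩, h⟩ :=
    exists_lt_of_csInf_lt (hX.image2 (f := dist) hY) (lt_add_of_pos_right (infSetDist X Y) hη)
  exact ⟨x, hx, y, hy, h⟩

theorem infSetDist_comm {E : Type*} [MetricSpace E] (X Y : Set E) :
    infSetDist X Y = infSetDist Y X := by
  rw [infSetDist, infSetDist, image2_swap]
  simp only [dist_comm]

theorem IsGeodesicSpace.exists_path {E : Type*} [MetricSpace E] (hgeo : IsGeodesicSpace E)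
    (x y : E) : ∃ c l, IsGeodesicPath c l ∧ c 0 = x ∧ c l = y := by
  obtain ⟨_, c, l, hc, h0, hl, -⟩ := hgeo x y
  exact ⟨c, l, hc, h0, hl⟩

theorem IsGeodesicPath.dist_eq {E : Type*} [MetricSpace E] {c : ℝ → E} {l : ℝ}
    (hc : IsGeodesicPath c l) : dist (c 0) (c l) = l := by
  rw [hc.2 0 (left_mem_Icc.2 hc.1) l (right_mem_Icc.2 hc.1), zero_sub, abs_neg,
    abs_of_nonneg hc.1]

theorem GeodesicConvex.path_mem {E : Type*} [MetricSpace E] {X : Set E} (hX : GeodesicConvex X)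
    {c : ℝ → E} {l : ℝ} (hc : IsGeodesicPath c l) (h0 : c 0 ∈ X) (hl : c l ∈ X) {t : ℝ}
    (ht : t ∈ Icc (0 : ℝ) 1) : c (t * l) ∈ X :=
  hX _ h0 _ hl _ hc.isGeodesicSegment
    (mem_image_of_mem c ⟨mul_nonneg ht.1 hc.1, mul_le_of_le_one_left hc.1 ht.2⟩)

theorem geodesicConvex_of_path_mem {E : Type*} [MetricSpace E] {X : Set E}
    (h : ∀ (c : ℝ → E) (l : ℝ), IsGeodesicPath c l → c 0 ∈ X → c l ∈ X →
      ∀ t ∈ Icc (0 : ℝ) 1, c (t * l) ∈ X) : GeodesicConvex X := by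
  rintro x hx y hy _ ⟨c, l, hc, rfl, rfl, rfl⟩ _ ⟨s, hs, rfl⟩
  rcases hc.1.eq_or_lt with rfl | hl
  · rwa [show s = 0 from le_antisymm hs.2 hs.1]
  · have := h c l hc hx hy (s / l) ⟨by have := hs.1; positivity, (div_le_one hl).2 hs.2⟩
    rwa [div_mul_cancel₀ _ hl.ne'] at this

theorem GeodesicConvexFun.geodesicConvex_le {E : Type*} [MetricSpace E] {f : E → ℝ}
    (hf : GeodesicConvexFun f) (r : ℝ) : GeodesicConvex {z | f z ≤ r} := by
  refine geodesicConvex_of_path_mem fun c l hc h0 hl t ht => (hf c l hc t ht).trans ?_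
  have h1 := mul_le_mul_of_nonneg_left (mem_ofPred.1 h0) (sub_nonneg.2 ht.2)
  have h2 := mul_le_mul_of_nonneg_left (mem_ofPred.1 hl) ht.1
  linarith

theorem HasConvexMetric.geodesicConvexFun_infDist {E : Type*} [MetricSpace E]
    (hgeo : IsGeodesicSpace E) (hconv : HasConvexMetric E) {X : Set E} (hX : GeodesicConvex X)
    (hne : X.Nonempty) : GeodesicConvexFun (infDist · X) := by
  intro c l hc t ht
  refine le_of_forall_pos_le_add fun η hη => ?_
  obtain ⟨p, hp, hpd⟩ := (infDist_lt_iff hne).1 (lt_add_of_pos_right (infDist (c 0) X) hη)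
  obtain ⟨q, hq, hqd⟩ := (infDist_lt_iff hne).1 (lt_add_of_pos_right (infDist (c l) X) hη)
  obtain ⟨c', l', hc', rfl, rfl⟩ := hgeo.exists_path p q
  have h1 := infDist_le_dist_of_mem (x := c (t * l)) (hX.path_mem hc' hp hq ht)
  have h2 := hconv c c' l l' hc hc' t ht
  have h3 := mul_le_mul_of_nonneg_left hpd.le (sub_nonneg.2 ht.2)
  have h4 := mul_le_mul_of_nonneg_left hqd.le ht.1
  linarith

theorem HasConvexMetric.geodesicConvexFun_dist {E : Type*} [MetricSpace E]
    (hconv : HasConvexMetric E) (y : E) : GeodesicConvexFun (dist · y) := by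
  intro c l hc t ht
  refine hconv c (fun _ => y) l 0 hc ⟨le_rfl, fun s hs t ht => ?_⟩ t ht
  rw [le_antisymm hs.2 hs.1, le_antisymm ht.2 ht.1]
  simp

theorem HasConvexMetric.geodesicConvex_petal {E : Type*} [MetricSpace E]
    (hgeo : IsGeodesicSpace E) (hconv : HasConvexMetric E) {X : Set E} (hX : GeodesicConvex X)
    (hne : X.Nonempty) {α : ℝ} (hα : 0 ≤ α) (y : E) (r : ℝ) :
    GeodesicConvex {z | infDist z X + α * dist z y ≤ r} := by
  refine GeodesicConvexFun.geodesicConvex_le (f := fun z => infDist z X + α * dist z y) ?_ r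
  intro c l hc t ht
  have h1 := hconv.geodesicConvexFun_infDist hgeo hX hne c l hc t ht
  have h2 := mul_le_mul_of_nonneg_left (hconv.geodesicConvexFun_dist y c l hc t ht) hα
  simp only at h1 h2 ⊢
  linarith

theorem Pbclcv.hausdorffEDist_ne_top {E : Type*} [MetricSpace E] (X Y : Pbclcv E) :
    hausdorffEDist X.1 Y.1 ≠ ⊤ :=
  hausdorffEDist_ne_top_of_nonempty_of_bounded X.2.1 Y.2.1 X.2.2.1 Y.2.2.1

theorem Pbclcv.exists_dist_lt {E : Type*} [MetricSpace E] {X Y : Pbclcv E} {δ : ℝ}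
    (h : dist X Y < δ) {x : E} (hx : x ∈ X.1) : ∃ y ∈ Y.1, dist x y < δ :=
  exists_dist_lt_of_hausdorffDist_lt hx h (X.hausdorffEDist_ne_top Y)

/-- The inclusion of `Pbclcv E` into the space of closed subsets of `E`. -/
def Pbclcv.toCloseds {E : Type*} [MetricSpace E] (X : Pbclcv E) : TopologicalSpace.Closeds E :=
  ⟨X.1, X.2.2.2.1⟩

theorem Pbclcv.isometry_toCloseds {E : Type*} [MetricSpace E] :
    Isometry (Pbclcv.toCloseds (E := E)) := by
  intro X Y
  rw [edist_dist, TopologicalSpace.Closeds.edist_eq]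
  exact (ENNReal.ofReal_toReal (X.hausdorffEDist_ne_top Y)).symm

theorem Pbclcv.isClosed_range_toCloseds {E : Type*} [MetricSpace E] (hgeo : IsGeodesicSpace E)
    (hconv : HasConvexMetric E) : IsClosed (range (Pbclcv.toCloseds (E := E))) := by
  refine isClosed_of_closure_subset fun C hC => ?_
  have approx : ∀ δ : ℝ, 0 < δ → ∃ X : Pbclcv E,
      (∀ x ∈ C, ∃ y ∈ X.1, dist x y < δ) ∧ ∀ y ∈ X.1, ∃ x ∈ C, dist y x < δ := by
    intro δ hδ
    obtain ⟨_, ⟨X, rfl⟩, hX⟩ := EMetric.mem_closure_iff.1 hC _ (ENNReal.ofReal_pos.2 hδ)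
    rw [TopologicalSpace.Closeds.edist_eq] at hX
    refine ⟨X, fun x hx => ?_, fun y hy => ?_⟩
    · obtain ⟨y, hy, h⟩ := exists_edist_lt_of_hausdorffEDist_lt hx hX
      exact ⟨y, hy, by rwa [edist_dist, ENNReal.ofReal_lt_ofReal_iff hδ] at h⟩
    · rw [hausdorffEDist_comm] at hX
      obtain ⟨x, hx, h⟩ := exists_edist_lt_of_hausdorffEDist_lt hy hX
      exact ⟨x, hx, by rwa [edist_dist, ENNReal.ofReal_lt_ofReal_iff hδ] at h⟩
  obtain ⟨X, hCX, hXC⟩ := approx 1 one_pos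
  refine ⟨⟨C, ?_, ?_, C.isClosed, ?_⟩, rfl⟩
  · obtain ⟨y, hy⟩ := X.2.1
    obtain ⟨x, hx, -⟩ := hXC y hy
    exact ⟨x, hx⟩
  · refine X.2.2.1.cthickening (δ := 1) |>.subset fun x hx => ?_
    obtain ⟨y, hy, h⟩ := hCX x hx
    exact mem_cthickening_of_dist_le x y 1 _ hy h.le
  · refine geodesicConvex_of_path_mem fun c l hc h0 hl t ht => ?_
    refine C.isClosed.closure_subset (Metric.mem_closure_iff.2 fun δ hδ => ?_)
    obtain ⟨X, hCX, hXC⟩ := approx (δ / 2) (half_pos hδ)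
    obtain ⟨p, hp, hpd⟩ := hCX _ h0
    obtain ⟨q, hq, hqd⟩ := hCX _ hl
    obtain ⟨c', l', hc', rfl, rfl⟩ := hgeo.exists_path p q
    obtain ⟨z, hz, hzd⟩ := hXC _ (X.2.2.2.2.path_mem hc' hp hq ht)
    refine ⟨z, hz, ?_⟩
    have h2 := hconv c c' l l' hc hc' t ht
    have h3 := mul_le_mul_of_nonneg_left hpd.le (sub_nonneg.2 ht.2)
    have h4 := mul_le_mul_of_nonneg_left hqd.le ht.1
    linarith [dist_triangle (c (t * l)) (c' (t * l')) z]

theorem Pbclcv.completeSpace {E : Type*} [MetricSpace E] [CompleteSpace E]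
    (hgeo : IsGeodesicSpace E) (hconv : HasConvexMetric E) : CompleteSpace (Pbclcv E) :=
  (completeSpace_iff_isComplete_range Pbclcv.isometry_toCloseds.isUniformInducing).2
    (Pbclcv.isClosed_range_toCloseds hgeo hconv).isComplete

theorem tendsto_dist_infSetDist {E : Type*} [MetricSpace E] {X Y : Set E} {x y : ℕ → E}
    (hx : ∀ n, x n ∈ X) (hy : ∀ n, y n ∈ Y)
    (h : ∀ n : ℕ, dist (x n) (y n) ≤ infSetDist X Y + 1 / ((n : ℝ) + 1)) :
    Tendsto (fun n => dist (x n) (y n)) atTop (nhds (infSetDist X Y)) := by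
  have hlim : Tendsto (fun n : ℕ => infSetDist X Y + 1 / ((n : ℝ) + 1)) atTop
      (nhds (infSetDist X Y)) := by
    simpa using tendsto_one_div_add_atTop_nhds_zero_nat.const_add (infSetDist X Y)
  exact tendsto_of_tendsto_of_tendsto_of_le_of_le tendsto_const_nhds hlim
    (fun n => infSetDist_le_dist (hx n) (hy n)) h

/-- For some `σ > 0`, any two `σ`-minimizing pairs for `min(X,Y)` are within `ρ`. -/
def AlmostMinWellPosed {E : Type*} [MetricSpace E] (X Y : Set E) (ρ : ℝ) : Prop :=
  ∃ σ > 0, ∀ x ∈ X, ∀ x' ∈ X, ∀ y ∈ Y, ∀ y' ∈ Y, dist x y ≤ infSetDist X Y + σ →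
    dist x' y' ≤ infSetDist X Y + σ → dist x x' ≤ ρ ∧ dist y y' ≤ ρ

theorem MinWellPosed.almostMinWellPosed {E : Type*} [MetricSpace E] {X Y : Set E}
    (h : MinWellPosed X Y) {ρ : ℝ} (hρ : 0 < ρ) : AlmostMinWellPosed X Y ρ := by
  obtain ⟨x₀, -, y₀, -, -, -, hlim⟩ := h
  obtain ⟨σ, hσ, hclose⟩ : ∃ σ > 0, ∀ x ∈ X, ∀ y ∈ Y, dist x y ≤ infSetDist X Y + σ →
      dist x x₀ < ρ / 2 ∧ dist y y₀ < ρ / 2 := by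
    by_contra! hcon
    choose x hx y hy hd hbad using fun n : ℕ => hcon (1 / ((n : ℝ) + 1)) (by positivity)
    obtain ⟨h₁, h₂⟩ := hlim x y hx hy (tendsto_dist_infSetDist hx hy hd)
    obtain ⟨n, hn₁, hn₂⟩ := ((h₁.eventually (ball_mem_nhds x₀ (half_pos hρ))).and
      (h₂.eventually (ball_mem_nhds y₀ (half_pos hρ)))).exists
    exact (hbad n hn₁).not_gt hn₂
  refine ⟨σ, hσ, fun x hx x' hx' y hy y' hy' h h' => ?_⟩
  obtain ⟨h₁, h₂⟩ := hclose x hx y hy h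
  obtain ⟨h₃, h₄⟩ := hclose x' hx' y' hy' h'
  exact ⟨by linarith [dist_triangle_right x x' x₀], by linarith [dist_triangle_right y y' y₀]⟩

theorem minWellPosed_of_forall_almostMinWellPosed {E : Type*} [MetricSpace E] [CompleteSpace E]
    {X Y : Set E} (hX : X.Nonempty) (hXc : IsClosed X) (hY : Y.Nonempty) (hYc : IsClosed Y)
    (h : ∀ ρ > 0, AlmostMinWellPosed X Y ρ) : MinWellPosed X Y := by
  choose x hx y hy hd using fun n : ℕ => exists_dist_lt_infSetDist_add hX hY
    (show 0 < 1 / ((n : ℝ) + 1) by positivity)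
  have hlim := tendsto_dist_infSetDist hx hy fun n => (hd n).le
  have hev : ∀ {d : ℕ → ℝ} {σ : ℝ}, 0 < σ → Tendsto d atTop (nhds (infSetDist X Y)) →
      ∀ᶠ n in atTop, d n ≤ infSetDist X Y + σ := fun hσ hd =>
    hd.eventually_le_const (lt_add_of_pos_right _ hσ)
  have hcauchy : ∀ ρ > 0, ∃ N, ∀ m ≥ N, ∀ n ≥ N,
      dist (x m) (x n) < ρ ∧ dist (y m) (y n) < ρ := by
    intro ρ hρ
    obtain ⟨σ, hσ, hclose⟩ := h (ρ / 2) (half_pos hρ)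
    obtain ⟨N, hN⟩ := eventually_atTop.1 (hev hσ hlim)
    refine ⟨N, fun m hm n hn => ?_⟩
    have := hclose _ (hx m) _ (hx n) _ (hy m) _ (hy n) (hN m hm) (hN n hn)
    exact ⟨this.1.trans_lt (half_lt_self hρ), this.2.trans_lt (half_lt_self hρ)⟩
  obtain ⟨x₀, hx₀⟩ := cauchySeq_tendsto_of_complete (Metric.cauchySeq_iff.2 fun ρ hρ =>
    (hcauchy ρ hρ).imp fun N hN m hm n hn => (hN m hm n hn).1)
  obtain ⟨y₀, hy₀⟩ := cauchySeq_tendsto_of_complete (Metric.cauchySeq_iff.2 fun ρ hρ =>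
    (hcauchy ρ hρ).imp fun N hN m hm n hn => (hN m hm n hn).2)
  have hx₀X := hXc.mem_of_tendsto hx₀ (Eventually.of_forall hx)
  have hy₀Y := hYc.mem_of_tendsto hy₀ (Eventually.of_forall hy)
  have hmin : dist x₀ y₀ = infSetDist X Y := tendsto_nhds_unique (hx₀.dist hy₀) hlim
  have hconv : ∀ u v : ℕ → E, (∀ n, u n ∈ X) → (∀ n, v n ∈ Y) →
      Tendsto (fun n => dist (u n) (v n)) atTop (nhds (infSetDist X Y)) →
      Tendsto u atTop (nhds x₀) ∧ Tendsto v atTop (nhds y₀) := by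
    intro u v hu hv huv
    have key : ∀ ρ > 0, ∀ᶠ n in atTop, dist (u n) x₀ < ρ ∧ dist (v n) y₀ < ρ := by
      intro ρ hρ
      obtain ⟨σ, hσ, hclose⟩ := h (ρ / 2) (half_pos hρ)
      filter_upwards [hev hσ huv] with n hn
      have := hclose _ (hu n) _ hx₀X _ (hv n) _ hy₀Y hn (by linarith)
      exact ⟨this.1.trans_lt (half_lt_self hρ), this.2.trans_lt (half_lt_self hρ)⟩
    exact ⟨Metric.tendsto_nhds.2 fun ρ hρ => (key ρ hρ).mono fun _ h => h.1,
      Metric.tendsto_nhds.2 fun ρ hρ => (key ρ hρ).mono fun _ h => h.2⟩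
  refine ⟨x₀, hx₀X, y₀, hy₀Y, hmin, fun u hu v hv huv => ?_, hconv⟩
  obtain ⟨h₁, h₂⟩ := hconv (fun _ => u) (fun _ => v) (fun _ => hu) (fun _ => hv)
    (huv ▸ tendsto_const_nhds)
  exact ⟨tendsto_nhds_unique tendsto_const_nhds h₁, tendsto_nhds_unique tendsto_const_nhds h₂⟩

theorem infSetDist_le_add_of_dist_lt {E : Type*} [MetricSpace E] {A : Set E} (hA : A.Nonempty)
    {X Y : Pbclcv E} {δ : ℝ} (h : dist X Y < δ) :
    infSetDist A Y.1 ≤ infSetDist A X.1 + δ := by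
  rw [← sub_le_iff_le_add]
  refine le_infSetDist hA X.2.1 fun a ha x hx => ?_
  obtain ⟨y, hy, hxy⟩ := Pbclcv.exists_dist_lt h hx
  linarith [infSetDist_le_dist ha hy, dist_triangle a x y]

theorem isOpen_almostMinWellPosed {E : Type*} [MetricSpace E] {A : Set E} (hA : A.Nonempty)
    (ρ : ℝ) : IsOpen {X : Pbclcv E | ∃ ρ' < ρ, AlmostMinWellPosed A X.1 ρ'} := by
  refine Metric.isOpen_iff.2 ?_
  rintro X ⟨ρ', hρ', σ, hσ, hclose⟩
  have hm : 0 < min (σ / 3) ((ρ - ρ') / 4) := lt_min (by linarith) (by linarith)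
  refine ⟨_, hm, fun Y hYX => ?_⟩
  rw [mem_ball] at hYX
  have hδ₁ := min_le_left (σ / 3) ((ρ - ρ') / 4)
  have hδ₂ := min_le_right (σ / 3) ((ρ - ρ') / 4)
  set δ := min (σ / 3) ((ρ - ρ') / 4)
  have hinf := infSetDist_le_add_of_dist_lt hA (dist_comm Y X ▸ hYX)
  refine ⟨ρ' + 2 * δ, by linarith, σ / 3, by positivity, fun a ha a' ha' y hy y' hy' h h' => ?_⟩
  obtain ⟨x, hx, hxy⟩ := Pbclcv.exists_dist_lt hYX hy
  obtain ⟨x', hx', hxy'⟩ := Pbclcv.exists_dist_lt hYX hy'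
  obtain ⟨h₁, h₂⟩ := hclose a ha a' ha' x hx x' hx' (by linarith [dist_triangle a y x])
    (by linarith [dist_triangle a' y' x'])
  exact ⟨by linarith, by linarith [dist_triangle4_right y y' x x']⟩

/-- Every `X` at positive distance from `A` is approximated by a petal around `X` whose tip `y` is
the only place where `A` is nearly reached. -/
theorem exists_almostMinWellPosed_dist_le {E : Type*} [MetricSpace E]
    (hgeo : IsGeodesicSpace E) (hconv : HasConvexMetric E) {κ : ℝ} (hκ : κ < 0)
    (hcurv : CurvBoundedBelow E κ) {A : Set E} (hA : A.Nonempty) (X : Pbclcv E)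
    {ε ρ : ℝ} (hε : 0 < ε) (hεX : ε < infSetDist A X.1)
    (hρ : 0 < ρ) :
    ∃ Y : Pbclcv E, dist Y X ≤ ε ∧ 0 < infSetDist A Y.1 ∧ AlmostMinWellPosed A Y.1 ρ := by
  obtain ⟨hXne, hXb, hXcl, hXcv⟩ := X.2
  set r := infSetDist A X.1 with hr
  obtain ⟨D, hD⟩ := Metric.isBounded_iff.1 hXb
  have hD0 : 0 ≤ D := by
    obtain ⟨x, hx⟩ := hXne
    simpa using hD hx hx
  obtain ⟨τ, hτ, hlens⟩ := hcurv.exists_dist_le hgeo hκ hε hεX (half_pos hρ)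
  obtain ⟨α, hα, hαD⟩ : ∃ α : ℝ, 0 < α ∧ α * (D + ε) = ε :=
    ⟨ε / (D + ε), by positivity, div_mul_cancel₀ _ (by positivity)⟩
  obtain ⟨δ, hδ, hδm⟩ : ∃ δ : ℝ, 0 < δ ∧ 2 * δ + 2 * δ / α ≤ min τ (ρ / 2) := by
    have hm : 0 < min τ (ρ / 2) := lt_min hτ (half_pos hρ)
    refine ⟨min τ (ρ / 2) / (2 + 2 / α), by positivity, le_of_eq ?_⟩
    field_simp
  have hδα : 0 < 2 * δ / α := by positivity
  obtain ⟨hδτ, hδρ⟩ := le_min_iff.1 hδm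
  obtain ⟨a, ha, x, hx, hax⟩ := exists_dist_lt_infSetDist_add hA hXne hδ
  rw [← hr] at hax
  have hrl : r ≤ dist x a := dist_comm a x ▸ infSetDist_le_dist ha hx
  rw [dist_comm] at hax
  obtain ⟨c, l, hc, rfl, rfl⟩ := hgeo.exists_path x a
  have hl := hc.dist_eq
  have hεmem : ε ∈ Icc 0 l := ⟨hε.le, by linarith⟩
  have hxy : dist (c 0) (c ε) = ε := by
    rw [hc.2 0 (left_mem_Icc.2 hc.1) ε hεmem, zero_sub, abs_neg, abs_of_pos hε]
  have hya : dist (c ε) (c l) = l - ε := by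
    rw [hc.2 ε hεmem l (right_mem_Icc.2 hc.1), abs_sub_comm, abs_of_nonneg (by linarith)]
  set y := c ε
  let Y : Set E := {z | infDist z X.1 + α * dist z y ≤ ε}
  have hXY : X.1 ⊆ Y := by
    intro z hz
    have : dist z y ≤ D + ε := (dist_triangle z (c 0) y).trans (add_le_add (hD hz hx) hxy.le)
    change infDist z X.1 + α * dist z y ≤ ε
    rw [infDist_zero_of_mem hz, zero_add, ← hαD]
    gcongr
  have hyY : y ∈ Y := by
    change infDist y X.1 + α * dist y y ≤ ε
    rw [dist_self, mul_zero, add_zero, ← hxy, dist_comm]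
    exact infDist_le_dist_of_mem hx
  have hYX : ∀ z ∈ Y, infDist z X.1 ≤ ε := fun z hz =>
    (le_add_of_nonneg_right (by positivity)).trans hz
  have hYb : IsBounded Y := by
    refine (isBounded_closedBall (x := y) (r := ε / α)).subset fun z hz => ?_
    rw [mem_closedBall, le_div_iff₀' hα]
    exact (le_add_of_nonneg_left infDist_nonneg).trans hz
  have hYc : IsClosed Y := isClosed_le (by have := continuous_infDist_pt X.1; fun_prop)
    continuous_const
  have hYcv : GeodesicConvex Y := hconv.geodesicConvex_petal hgeo hXcv hXne hα.le y ε
  have hdist : ∀ a' ∈ A, ∀ z, r - dist a' z ≤ infDist z X.1 := fun a' ha' z =>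
    (le_infDist hXne).2 fun {x'} hx' => by
      linarith [infSetDist_le_dist ha' hx', dist_triangle a' z x']
  have hYle : infSetDist A Y ≤ r - ε + δ := by
    linarith [infSetDist_le_dist ha hyY, dist_comm y (c l)]
  have hnear : ∀ a' ∈ A, ∀ z ∈ Y, dist a' z ≤ infSetDist A Y + δ →
      dist (c l) a' ≤ ρ / 2 ∧ dist z y ≤ ρ / 2 := by
    intro a' ha' z hz hd
    have h₁ : α * dist z y ≤ 2 * δ := by
      have : infDist z X.1 + α * dist z y ≤ ε := hz
      linarith [hdist a' ha' z]
    have h₂ : dist z y ≤ 2 * δ / α := (le_div_iff₀' hα).2 h₁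
    refine ⟨hlens _ (c 0) (c l) y a' hc.isGeodesicSegment (mem_image_of_mem c hεmem) hxy
      (by linarith) hrl (by linarith) (dist_comm a' (c 0) ▸ infSetDist_le_dist ha' hx) ?_,
      by linarith⟩
    linarith [dist_triangle y z a', dist_comm y z, dist_comm z a']
  refine ⟨⟨Y, ⟨y, hyY⟩, hYb, hYc, hYcv⟩, ?_, ?_, δ, hδ, fun a' ha' a'' ha'' z hz z' hz' h h' => ?_⟩
  · exact hausdorffDist_le_of_infDist hε.le hYX fun z hz => by
      rw [infDist_zero_of_mem (hXY hz)]; exact hε.le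
  · refine (sub_pos.2 hεX).trans_le (le_infSetDist hA ⟨y, hyY⟩ fun a' ha' z hz => ?_)
    linarith [hdist a' ha' z, hYX z hz]
  · obtain ⟨h₁, h₂⟩ := hnear a' ha' z hz h
    obtain ⟨h₃, h₄⟩ := hnear a'' ha'' z' hz' h'
    exact ⟨by linarith [dist_triangle_left a' a'' (c l)],
      by linarith [dist_triangle_right z z' y]⟩

/-- in a complete geodesic space with convex metric and curvature
bounded below, the family of sets for which `min(A,X)` is well-posed is a dense
`G_δ`-set in `P^A_{b,cl,cv}(E)`. -/
theorem statement5 {E : Type*} [MetricSpace E] [CompleteSpace E]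
    (hgeo : IsGeodesicSpace E) (hconv : HasConvexMetric E)
    (κ : ℝ) (hκ : κ < 0) (hcurv : CurvBoundedBelow E κ)
    (A : Set E) (hA : A.Nonempty) (hAb : IsBounded A) (hAc : IsClosed A) :
    Dense {X : ↥(PAbclcv A) | MinWellPosed A X.1.1} ∧
    IsGδ {X : ↥(PAbclcv A) | MinWellPosed A X.1.1} := by
  have : CompleteSpace (Pbclcv E) := Pbclcv.completeSpace hgeo hconv
  have : CompleteSpace ↥(PAbclcv A) := isClosed_closure.completeSpace_coe
  let U : ℕ → Set ↥(PAbclcv A) := fun n =>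
    {X | ∃ ρ < 1 / ((n : ℝ) + 1), AlmostMinWellPosed A X.1.1 ρ}
  have hU : {X : ↥(PAbclcv A) | MinWellPosed A X.1.1} = ⋂ n, U n := by
    ext X
    rw [mem_iInter]
    constructor
    · intro hX n
      exact ⟨1 / ((n : ℝ) + 1) / 2, half_lt_self (by positivity),
        MinWellPosed.almostMinWellPosed hX (by positivity)⟩
    · intro hX
      refine minWellPosed_of_forall_almostMinWellPosed hA hAc X.1.2.1 X.1.2.2.2.1 fun ρ hρ => ?_
      obtain ⟨n, hn⟩ := exists_nat_one_div_lt hρ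
      obtain ⟨ρ', hρ', σ, hσ, h⟩ := hX n
      refine ⟨σ, hσ, fun a ha a' ha' x hx x' hx' hd hd' => ?_⟩
      have := h a ha a' ha' x hx x' hx' hd hd'
      exact ⟨by linarith, by linarith⟩
  have hopen : ∀ n, IsOpen (U n) := fun n =>
    (isOpen_almostMinWellPosed hA _).preimage continuous_subtype_val
  have hdense : ∀ n, Dense (U n) := by
    refine fun n => Metric.dense_iff.2 fun X ε hε => ?_
    obtain ⟨Z, hZ, hXZ⟩ := Metric.mem_closure_iff.1 X.2 (ε / 2) (half_pos hε)
    have hZ : 0 < infSetDist A Z.1 := infSetDist_comm Z.1 A ▸ hZ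
    obtain ⟨Y, hYZ, hY, hwp⟩ := exists_almostMinWellPosed_dist_le hgeo hconv hκ hcurv hA Z
      (ε := min (ε / 3) (infSetDist A Z.1 / 2)) (ρ := 1 / ((n : ℝ) + 1) / 2)
      (lt_min (by positivity) (half_pos hZ)) ((min_le_right _ _).trans_lt (half_lt_self hZ)) (by positivity)
    refine ⟨⟨Y, subset_closure (hY.trans_eq (infSetDist_comm A Y.1))⟩, ?_, _,
      half_lt_self (by positivity), hwp⟩
    rw [mem_ball, Subtype.dist_eq]
    linarith [dist_triangle_right Y X.1 Z, min_le_left (ε / 3) (infSetDist A Z.1 / 2)]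
  rw [hU]
  exact ⟨dense_iInter_of_isOpen_nat hopen hdense, .iInter_of_isOpen hopen⟩
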